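/- For $a \in (0,\pi/2)$ and $\xi_1 \in (a,\pi/2]$, $\frac{\partial}{\partial a}\int_0^{+\infty} X(\xi_1,t,a)\, dt = \cot a \, \ln\cos a$; in particular this quantity is independent of $\xi_1$ on $(a,\pi/2]$. -/

import Mathlib

open MeasureTheory Real Set

noncomputable def pd1 (f : ℝ × ℝ → ℝ) (p : ℝ × ℝ) : ℝ :=
  deriv (fun t => f (t, p.2)) p.1

noncomputable def pd2 (f : ℝ × ℝ → ℝ) (p : ℝ × ℝ) : ℝ :=
  deriv (fun t => f (p.1, t)) p.2

/-- `X(ξ,a) = Re log(sin z + (sin² z − sin² a)^{1/2}) − ξ₂`, `z = ξ₁ + i ξ₂`. -/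
noncomputable def Xfun (a : ℝ) (ξ : ℝ × ℝ) : ℝ :=
  (Complex.log (Complex.sin ((ξ.1 : ℂ) + (ξ.2 : ℂ) * Complex.I) +
      (Complex.sin ((ξ.1 : ℂ) + (ξ.2 : ℂ) * Complex.I) ^ 2 - Complex.sin (a : ℂ) ^ 2)
        ^ ((1 : ℂ)/2))).re - ξ.2

/-- `Y(ξ,a) = Im log(sin z + (sin² z − sin² a)^{1/2}) − π/2 + ξ₁`. -/
noncomputable def Yfun (a : ℝ) (ξ : ℝ × ℝ) : ℝ :=
  (Complex.log (Complex.sin ((ξ.1 : ℂ) + (ξ.2 : ℂ) * Complex.I) +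
      (Complex.sin ((ξ.1 : ℂ) + (ξ.2 : ℂ) * Complex.I) ^ 2 - Complex.sin (a : ℂ) ^ 2)
        ^ ((1 : ℂ)/2))).im - π/2 + ξ.1

/-- The half-period strip `Π = (−π/2, π/2) × (0, ∞)`. -/
noncomputable def PiStrip : Set (ℝ × ℝ) := (Set.Ioo (-(π/2)) (π/2)) ×ˢ (Set.Ioi (0 : ℝ))

open Filter Topology

/-- `sin (x + i t)`. -/
noncomputable def sinStrip (x t : ℝ) : ℂ := Complex.sin ((x : ℂ) + (t : ℂ) * Complex.I)

/-- `cos (x + i t)`. -/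
noncomputable def cosStrip (x t : ℝ) : ℂ := Complex.cos ((x : ℂ) + (t : ℂ) * Complex.I)

/-- The principal square root of `sin² (x + i t) - sin² b`. -/
noncomputable def rootStrip (b x t : ℝ) : ℂ :=
  (sinStrip x t ^ 2 - Complex.sin (b : ℂ) ^ 2) ^ ((1 : ℂ) / 2)

lemma Xfun_eq (b x t : ℝ) :
    Xfun b (x, t) = (Complex.log (sinStrip x t + rootStrip b x t)).re - t := rfl

lemma sinStrip_re (x t : ℝ) : (sinStrip x t).re = Real.sin x * Real.cosh t := by
  simp [sinStrip, Complex.sin_add_mul_I, ← Complex.ofReal_sin, ← Complex.ofReal_cos,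
    ← Complex.ofReal_cosh, ← Complex.ofReal_sinh]

lemma sinStrip_im (x t : ℝ) : (sinStrip x t).im = Real.cos x * Real.sinh t := by
  simp [sinStrip, Complex.sin_add_mul_I, ← Complex.ofReal_sin, ← Complex.ofReal_cos,
    ← Complex.ofReal_cosh, ← Complex.ofReal_sinh]

lemma cosStrip_im (x t : ℝ) : (cosStrip x t).im = -(Real.sin x * Real.sinh t) := by
  simp [cosStrip, Complex.cos_add_mul_I, ← Complex.ofReal_sin, ← Complex.ofReal_cos,
    ← Complex.ofReal_cosh, ← Complex.ofReal_sinh]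

lemma norm_sinStrip_add_I_mul_cosStrip (x t : ℝ) :
    ‖sinStrip x t + Complex.I * cosStrip x t‖ = Real.exp t := by
  have h : sinStrip x t + Complex.I * cosStrip x t
      = Complex.I * Complex.exp (-((x : ℂ) + (t : ℂ) * Complex.I) * Complex.I) := by
    rw [Complex.exp_mul_I, Complex.cos_neg, Complex.sin_neg, sinStrip, cosStrip]
    linear_combination Complex.sin ((x : ℂ) + (t : ℂ) * Complex.I) * Complex.I_sq
  rw [h, norm_mul, Complex.norm_I, one_mul, Complex.norm_exp]
  simp

lemma norm_sinStrip_sub_I_mul_cosStrip (x t : ℝ) :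
    ‖sinStrip x t - Complex.I * cosStrip x t‖ = Real.exp (-t) := by
  have h : sinStrip x t - Complex.I * cosStrip x t
      = -Complex.I * Complex.exp (((x : ℂ) + (t : ℂ) * Complex.I) * Complex.I) := by
    rw [Complex.exp_mul_I, sinStrip, cosStrip]
    linear_combination Complex.sin ((x : ℂ) + (t : ℂ) * Complex.I) * Complex.I_sq
  rw [h, norm_mul, norm_neg, Complex.norm_I, one_mul, Complex.norm_exp]
  simp

lemma hasDerivAt_sinStrip (x t : ℝ) :
    HasDerivAt (sinStrip x) (cosStrip x t * Complex.I) t := by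
  have h : HasDerivAt (fun s : ℝ => (x : ℂ) + (s : ℂ) * Complex.I) Complex.I t := by
    simpa using ((Complex.ofRealCLM.hasDerivAt (x := t)).mul_const Complex.I).const_add (x : ℂ)
  refine ((Complex.hasDerivAt_sin ((x : ℂ) + (t : ℂ) * Complex.I)).scomp t h).congr_deriv ?_
  rw [smul_eq_mul, mul_comm]
  rfl

lemma hasDerivAt_cosStrip (x t : ℝ) :
    HasDerivAt (cosStrip x) (-sinStrip x t * Complex.I) t := by
  have h : HasDerivAt (fun s : ℝ => (x : ℂ) + (s : ℂ) * Complex.I) Complex.I t := by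
    simpa using ((Complex.ofRealCLM.hasDerivAt (x := t)).mul_const Complex.I).const_add (x : ℂ)
  refine ((Complex.hasDerivAt_cos ((x : ℂ) + (t : ℂ) * Complex.I)).scomp t h).congr_deriv ?_
  rw [smul_eq_mul, mul_comm]
  rfl

lemma cpow_half_sq (w : ℂ) : (w ^ ((1 : ℂ) / 2)) ^ 2 = w := by
  simp

lemma cpow_half_re_pos {w : ℂ} (hw : w ∈ Complex.slitPlane) : 0 < (w ^ ((1 : ℂ) / 2)).re := by
  rw [Complex.cpow_def_of_ne_zero (Complex.slitPlane_ne_zero hw), Complex.exp_re]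
  refine mul_pos (Real.exp_pos _) (Real.cos_pos_of_mem_Ioo ?_)
  have h1 := Complex.neg_pi_lt_arg w
  have h2 := lt_of_le_of_ne (Complex.arg_le_pi w) (Complex.mem_slitPlane_iff_arg.1 hw).1
  have h3 : (Complex.log w * (1 / 2)).im = w.arg / 2 := by
    simp [Complex.mul_im, Complex.log_im, div_eq_mul_inv]
  rw [h3]
  constructor <;> linarith

lemma HasDerivAt.cpow_half {f : ℝ → ℂ} {f' : ℂ} {t : ℝ} (hf : HasDerivAt f f' t)
    (h : f t ∈ Complex.slitPlane) :
    HasDerivAt (fun s => f s ^ ((1 : ℂ) / 2)) (f' / (2 * f t ^ ((1 : ℂ) / 2))) t := by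
  have h0 := Complex.slitPlane_ne_zero h
  have hr : f t ^ ((1 : ℂ) / 2) ≠ 0 := fun e => by
    have := cpow_half_re_pos h
    rw [e] at this
    exact lt_irrefl _ this
  have key := (Complex.hasStrictDerivAt_cpow_const (c := (1 : ℂ) / 2) h).hasDerivAt.scomp t hf
  refine key.congr_deriv ?_
  rw [smul_eq_mul, Complex.cpow_sub _ _ h0, Complex.cpow_one]
  have hsq := cpow_half_sq (f t)
  field_simp
  rw [hsq]

lemma abs_log_le_of_le {c y : ℝ} (hc : 0 < c) (hc1 : c ≤ 1) (hy : c ≤ y) :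
    |Real.log y| ≤ |y - 1| / c := by
  have hy0 : 0 < y := hc.trans_le hy
  have h1 : |y - 1| ≤ |y - 1| / c := le_div_self (abs_nonneg _) hc hc1
  have h2 : |y - 1| / y ≤ |y - 1| / c := by gcongr
  rw [abs_le]
  constructor
  · have h3 := Real.log_le_sub_one_of_pos (inv_pos.2 hy0)
    rw [Real.log_inv] at h3
    have h4 : y⁻¹ - 1 = (1 - y) / y := by field_simp
    have h5 : (1 - y) / y ≤ |y - 1| / y := by
      gcongr
      rw [abs_sub_comm]
      exact le_abs_self _
    linarith
  · have h3 := Real.log_le_sub_one_of_pos hy0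
    have h4 := le_abs_self (y - 1)
    linarith

section Strip

variable {b x t : ℝ}

lemma rootStrip_sq (b x t : ℝ) :
    rootStrip b x t ^ 2 = sinStrip x t ^ 2 - Complex.sin (b : ℂ) ^ 2 := cpow_half_sq _

lemma sin_lt_sin_of_strip (hb : 0 < b) (hbx : b < x) (hx : x ≤ π / 2) :
    0 < Real.sin b ∧ Real.sin b < Real.sin x := by
  have := Real.pi_pos
  exact ⟨Real.sin_pos_of_pos_of_lt_pi hb (by linarith),
    Real.sin_lt_sin_of_lt_of_le_pi_div_two (by linarith) hx hbx⟩

lemma sinStrip_sq_sub_mem_slitPlane (hb : 0 < b) (hbx : b < x) (hx : x ≤ π / 2) (t : ℝ) :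
    sinStrip x t ^ 2 - Complex.sin (b : ℂ) ^ 2 ∈ Complex.slitPlane := by
  obtain ⟨hs, hsx⟩ := sin_lt_sin_of_strip hb hbx hx
  have hre : (sinStrip x t ^ 2 - Complex.sin (b : ℂ) ^ 2).re
      = (Real.sin x * Real.cosh t) ^ 2 - (Real.cos x * Real.sinh t) ^ 2 - Real.sin b ^ 2 := by
    rw [Complex.sub_re, sq, Complex.mul_re, sinStrip_re, sinStrip_im, ← Complex.ofReal_sin,
      ← Complex.ofReal_pow, Complex.ofReal_re]
    ring
  have him : (sinStrip x t ^ 2 - Complex.sin (b : ℂ) ^ 2).im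
      = 2 * (Real.sin x * Real.cosh t) * (Real.cos x * Real.sinh t) := by
    rw [Complex.sub_im, sq, Complex.mul_im, sinStrip_re, sinStrip_im, ← Complex.ofReal_sin,
      ← Complex.ofReal_pow, Complex.ofReal_im]
    ring
  rw [Complex.mem_slitPlane_iff, hre, him]
  by_cases h : Real.cos x * Real.sinh t = 0
  · left
    rw [h]
    have hc := Real.one_le_cosh t
    have : Real.sin b < Real.sin x * Real.cosh t := by nlinarith
    nlinarith
  · right
    have hc := Real.cosh_pos t
    have : 0 < Real.sin x := hs.trans hsx
    positivity

lemma rootStrip_re_pos (hb : 0 < b) (hbx : b < x) (hx : x ≤ π / 2) (t : ℝ) :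
    0 < (rootStrip b x t).re :=
  cpow_half_re_pos (sinStrip_sq_sub_mem_slitPlane hb hbx hx t)

lemma rootStrip_ne_zero (hb : 0 < b) (hbx : b < x) (hx : x ≤ π / 2) (t : ℝ) :
    rootStrip b x t ≠ 0 := fun e => by
  have := rootStrip_re_pos hb hbx hx t
  simp [e] at this

lemma le_re_sinStrip_add_rootStrip (hb : 0 < b) (hbx : b < x) (hx : x ≤ π / 2) (t : ℝ) :
    Real.sin x * Real.cosh t ≤ (sinStrip x t + rootStrip b x t).re := by
  have := rootStrip_re_pos hb hbx hx t
  rw [Complex.add_re, sinStrip_re]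
  linarith

lemma re_sinStrip_add_rootStrip_pos (hb : 0 < b) (hbx : b < x) (hx : x ≤ π / 2) (t : ℝ) :
    0 < (sinStrip x t + rootStrip b x t).re := by
  obtain ⟨hs, hsx⟩ := sin_lt_sin_of_strip hb hbx hx
  exact (mul_pos (hs.trans hsx) (Real.cosh_pos t)).trans_le
    (le_re_sinStrip_add_rootStrip hb hbx hx t)

lemma sinStrip_add_rootStrip_ne_zero (hb : 0 < b) (hbx : b < x) (hx : x ≤ π / 2) (t : ℝ) :
    sinStrip x t + rootStrip b x t ≠ 0 := fun e => by
  have := re_sinStrip_add_rootStrip_pos hb hbx hx t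
  simp [e] at this

lemma le_norm_sinStrip_add_rootStrip (hb : 0 < b) (hbx : b < x) (hx : x ≤ π / 2) (t : ℝ) :
    Real.sin x * Real.cosh t ≤ ‖sinStrip x t + rootStrip b x t‖ :=
  (le_re_sinStrip_add_rootStrip hb hbx hx t).trans (Complex.re_le_norm _)

lemma re_rootStrip_add_I_mul_cosStrip_pos (hb : 0 < b) (hbx : b < x) (hx : x ≤ π / 2)
    (ht : 0 ≤ t) : 0 < (rootStrip b x t + Complex.I * cosStrip x t).re := by
  obtain ⟨hs, hsx⟩ := sin_lt_sin_of_strip hb hbx hx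
  have h1 := rootStrip_re_pos hb hbx hx t
  have h2 := mul_nonneg (hs.trans hsx).le (Real.sinh_nonneg_iff.2 ht)
  rw [Complex.add_re, Complex.I_mul_re, cosStrip_im]
  linarith

lemma sq_mul_cosh_sq_le_norm_rootStrip_sq (hb : 0 < b) (hbx : b < x) (hx : x ≤ π / 2) (t : ℝ) :
    (Real.sin x ^ 2 - Real.sin b ^ 2) * Real.cosh t ^ 2 ≤ ‖rootStrip b x t‖ ^ 2 := by
  obtain ⟨hs, hsx⟩ := sin_lt_sin_of_strip hb hbx hx
  have hc := Real.one_le_cosh t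
  have hlt : Real.sin b < Real.sin x * Real.cosh t := by nlinarith
  have h1 : Real.sin x * Real.cosh t - Real.sin b ≤ ‖sinStrip x t - Complex.sin (b : ℂ)‖ := by
    refine le_trans (le_of_eq ?_) (Complex.re_le_norm _)
    rw [Complex.sub_re, sinStrip_re, Complex.sin_ofReal_re]
  have h2 : Real.sin x * Real.cosh t + Real.sin b ≤ ‖sinStrip x t + Complex.sin (b : ℂ)‖ := by
    refine le_trans (le_of_eq ?_) (Complex.re_le_norm _)
    rw [Complex.add_re, sinStrip_re, Complex.sin_ofReal_re]
  have h3 : ‖rootStrip b x t‖ ^ 2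
      = ‖sinStrip x t - Complex.sin (b : ℂ)‖ * ‖sinStrip x t + Complex.sin (b : ℂ)‖ := by
    rw [← norm_pow, rootStrip_sq, ← norm_mul]
    ring_nf
  have h4 := mul_le_mul h1 h2 (by nlinarith) (norm_nonneg _)
  rw [h3]
  nlinarith [mul_nonneg (sq_nonneg (Real.sin b)) (sub_nonneg.2 (one_le_pow₀ hc (n := 2)))]

lemma norm_rootStrip_sub_sinStrip_le (hb : 0 < b) (hbx : b < x) (hx : x ≤ π / 2) (t : ℝ) :
    ‖rootStrip b x t - sinStrip x t‖ ≤ 1 / Real.sin x := by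
  obtain ⟨hs, hsx⟩ := sin_lt_sin_of_strip hb hbx hx
  have h0 := hs.trans hsx
  have h1 := le_norm_sinStrip_add_rootStrip hb hbx hx t
  have h2 : ‖rootStrip b x t - sinStrip x t‖ * ‖sinStrip x t + rootStrip b x t‖
      = Real.sin b ^ 2 := by
    rw [← norm_mul, show (rootStrip b x t - sinStrip x t) * (sinStrip x t + rootStrip b x t)
      = -Complex.sin (b : ℂ) ^ 2 by linear_combination rootStrip_sq b x t]
    rw [norm_neg, norm_pow, ← Complex.ofReal_sin, Complex.norm_real, Real.norm_eq_abs, sq_abs]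
  have h3 := Real.sin_sq_le_one b
  have h4 : Real.sin x ≤ ‖sinStrip x t + rootStrip b x t‖ := by
    nlinarith [Real.one_le_cosh t]
  rw [le_div_iff₀ h0]
  nlinarith [norm_nonneg (rootStrip b x t - sinStrip x t)]

/-- The derivative of `X` in the parameter. -/
lemma hasDerivAt_Xfun_param (hb : 0 < b) (hbx : b < x) (hx : x ≤ π / 2) (t : ℝ) :
    HasDerivAt (fun b => Xfun b (x, t))
      (-(Real.cos b / Real.sin b) * ((sinStrip x t / rootStrip b x t).re - 1)) b := by
  have hs : (Real.sin b : ℂ) ≠ 0 := by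
    exact_mod_cast (sin_lt_sin_of_strip hb hbx hx).1.ne'
  have hR := rootStrip_ne_zero hb hbx hx t
  have hSR := sinStrip_add_rootStrip_ne_zero hb hbx hx t
  have hsin : HasDerivAt (fun b : ℝ => Complex.sin (b : ℂ)) (Complex.cos b) b :=
    (Complex.hasDerivAt_sin (b : ℂ)).comp_ofReal
  have h1 : HasDerivAt (fun b : ℝ => rootStrip b x t)
      (-(2 * Complex.sin b * Complex.cos b) / (2 * rootStrip b x t)) b := by
    refine HasDerivAt.cpow_half ?_ (sinStrip_sq_sub_mem_slitPlane hb hbx hx t)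
    simpa using (hsin.pow 2).const_sub (sinStrip x t ^ 2)
  have h2 := (h1.const_add (sinStrip x t)).clog_real
    (Or.inl (re_sinStrip_add_rootStrip_pos hb hbx hx t))
  have h3 := (Complex.reCLM.hasFDerivAt.comp_hasDerivAt b h2).sub_const t
  refine h3.congr_deriv ?_
  have h4 : -(2 * Complex.sin b * Complex.cos b) / (2 * rootStrip b x t)
        / (sinStrip x t + rootStrip b x t)
      = ((-(Real.cos b / Real.sin b) : ℝ) : ℂ) * (sinStrip x t / rootStrip b x t - 1) := by
    push_cast at hs ⊢
    field_simp
    linear_combination -Complex.cos b * rootStrip_sq b x t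
  rw [Complex.reCLM_apply, h4, Complex.re_ofReal_mul, Complex.sub_re, Complex.one_re]

/-- A primitive in `t` of the derivative of `X` in the parameter. -/
lemma hasDerivAt_log_rootStrip_add (hb : 0 < b) (hbx : b < x) (hx : x ≤ π / 2) (ht : 0 ≤ t) :
    HasDerivAt (fun t => (Complex.log (rootStrip b x t + Complex.I * cosStrip x t)).re - t)
      ((sinStrip x t / rootStrip b x t).re - 1) t := by
  have hR := rootStrip_ne_zero hb hbx hx t
  have hpos := re_rootStrip_add_I_mul_cosStrip_pos hb hbx hx ht
  have hRC : rootStrip b x t + Complex.I * cosStrip x t ≠ 0 := fun e => by simp [e] at hpos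
  have h1 : HasDerivAt (rootStrip b x)
      (2 * sinStrip x t * (cosStrip x t * Complex.I) / (2 * rootStrip b x t)) t := by
    refine HasDerivAt.cpow_half ?_ (sinStrip_sq_sub_mem_slitPlane hb hbx hx t)
    simpa using ((hasDerivAt_sinStrip x t).pow 2).sub_const (Complex.sin (b : ℂ) ^ 2)
  have h2 := (h1.add ((hasDerivAt_cosStrip x t).const_mul Complex.I)).clog_real (Or.inl hpos)
  have h3 := (Complex.reCLM.hasFDerivAt.comp_hasDerivAt t h2).sub (hasDerivAt_id t)
  refine h3.congr_deriv ?_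
  have h4 : (2 * sinStrip x t * (cosStrip x t * Complex.I) / (2 * rootStrip b x t)
        + Complex.I * (-sinStrip x t * Complex.I)) / (rootStrip b x t + Complex.I * cosStrip x t)
      = sinStrip x t / rootStrip b x t := by
    rw [div_eq_iff hRC]
    field_simp
    linear_combination -sinStrip x t * rootStrip b x t * Complex.I_sq
  rw [Complex.reCLM_apply, ← h4]
  rfl

lemma abs_norm_mul_exp_neg_sub_one_le {w v : ℂ} {t : ℝ} (hv : ‖v‖ = Real.exp t) :
    |‖w‖ * Real.exp (-t) - 1| ≤ ‖w - v‖ * Real.exp (-t) := by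
  have h : ‖w‖ * Real.exp (-t) - 1 = (‖w‖ - ‖v‖) * Real.exp (-t) := by
    rw [hv, sub_mul, ← Real.exp_add, add_neg_cancel, Real.exp_zero]
  rw [h, abs_mul, abs_of_pos (Real.exp_pos _)]
  gcongr
  exact abs_norm_sub_norm_le w v

lemma log_re_sub {w : ℂ} (hw : w ≠ 0) (t : ℝ) :
    (Complex.log w).re - t = Real.log (‖w‖ * Real.exp (-t)) := by
  rw [Complex.log_re, Real.log_mul (norm_ne_zero_iff.2 hw) (Real.exp_ne_zero _), Real.log_exp]
  ring

lemma exp_div_two_le_cosh (t : ℝ) : Real.exp t / 2 ≤ Real.cosh t := by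
  rw [Real.cosh_eq]
  linarith [Real.exp_pos (-t)]

lemma abs_Xfun_le (hb : 0 < b) (hbx : b < x) (hx : x ≤ π / 2) (ht : 0 ≤ t) :
    |Xfun b (x, t)| ≤ (1 + 1 / Real.sin x) / (Real.sin x / 2) * Real.exp (-t) := by
  obtain ⟨hs, hsx⟩ := sin_lt_sin_of_strip hb hbx hx
  have h0 := hs.trans hsx
  rw [Xfun_eq, log_re_sub (sinStrip_add_rootStrip_ne_zero hb hbx hx t)]
  have hlow : Real.sin x / 2 ≤ ‖sinStrip x t + rootStrip b x t‖ * Real.exp (-t) := by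
    have h1 : Real.sin x * (Real.exp t / 2) * Real.exp (-t) = Real.sin x / 2 := by
      rw [show Real.sin x * (Real.exp t / 2) * Real.exp (-t)
        = Real.sin x / 2 * (Real.exp t * Real.exp (-t)) by ring, ← Real.exp_add, add_neg_cancel,
        Real.exp_zero, mul_one]
    rw [← h1]
    gcongr
    exact (mul_le_mul_of_nonneg_left (exp_div_two_le_cosh t) h0.le).trans
      (le_norm_sinStrip_add_rootStrip hb hbx hx t)
  refine (abs_log_le_of_le (by positivity) (by linarith [Real.sin_le_one x]) hlow).trans ?_
  rw [div_mul_eq_mul_div]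
  gcongr
  refine (abs_norm_mul_exp_neg_sub_one_le (norm_sinStrip_add_I_mul_cosStrip x t)).trans ?_
  gcongr
  rw [show sinStrip x t + rootStrip b x t - (sinStrip x t + Complex.I * cosStrip x t)
    = (sinStrip x t - Complex.I * cosStrip x t) + (rootStrip b x t - sinStrip x t) by ring]
  refine (norm_add_le _ _).trans (add_le_add ?_ (norm_rootStrip_sub_sinStrip_le hb hbx hx t))
  rw [norm_sinStrip_sub_I_mul_cosStrip]
  exact Real.exp_le_one_iff.2 (by linarith)

lemma measurable_Xfun_snd (b x : ℝ) : Measurable (fun t => Xfun b (x, t)) := by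
  unfold Xfun
  fun_prop

lemma integrableOn_Xfun (hb : 0 < b) (hbx : b < x) (hx : x ≤ π / 2) :
    IntegrableOn (fun t => Xfun b (x, t)) (Ioi 0) := by
  refine ((integrableOn_exp_neg_Ioi 0).const_mul
    ((1 + 1 / Real.sin x) / (Real.sin x / 2))).mono'
    (measurable_Xfun_snd b x).aestronglyMeasurable ?_
  filter_upwards [ae_restrict_mem measurableSet_Ioi] with t ht
  exact abs_Xfun_le hb hbx hx (le_of_lt ht)

lemma tendsto_log_rootStrip_add (hb : 0 < b) (hbx : b < x) (hx : x ≤ π / 2) :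
    Tendsto (fun t => (Complex.log (rootStrip b x t + Complex.I * cosStrip x t)).re - t)
      atTop (𝓝 0) := by
  have h1 : Tendsto (fun t => ‖rootStrip b x t + Complex.I * cosStrip x t‖ * Real.exp (-t))
      atTop (𝓝 1) := by
    rw [tendsto_iff_dist_tendsto_zero]
    have h2 : Tendsto (fun t => 1 / Real.sin x * Real.exp (-t)) atTop (𝓝 0) := by
      simpa using Real.tendsto_exp_neg_atTop_nhds_zero.const_mul (1 / Real.sin x)
    refine squeeze_zero' (Eventually.of_forall fun _ => dist_nonneg) ?_ h2
    filter_upwards [eventually_ge_atTop 0] with t ht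
    refine (abs_norm_mul_exp_neg_sub_one_le (norm_sinStrip_add_I_mul_cosStrip x t)).trans ?_
    rw [add_sub_add_right_eq_sub]
    gcongr
    exact norm_rootStrip_sub_sinStrip_le hb hbx hx t
  have h3 := h1.log one_ne_zero
  rw [Real.log_one] at h3
  refine h3.congr' ?_
  filter_upwards [eventually_ge_atTop 0] with t ht
  refine (log_re_sub (fun e => ?_) t).symm
  have := re_rootStrip_add_I_mul_cosStrip_pos hb hbx hx ht
  simp [e] at this

lemma norm_rootStrip_add_I_mul_cosStrip_zero (hb : 0 < b) (hbx : b < x) (hx : x ≤ π / 2) :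
    ‖rootStrip b x 0 + Complex.I * cosStrip x 0‖ = Real.cos b := by
  have hR : (0 : ℝ) < (rootStrip b x 0).re := rootStrip_re_pos hb hbx hx 0
  have hS : sinStrip x 0 = (Real.sin x : ℂ) := by simp [sinStrip]
  have hC : cosStrip x 0 = (Real.cos x : ℂ) := by simp [cosStrip]
  have hsq := rootStrip_sq b x 0
  rw [hS, ← Complex.ofReal_sin] at hsq
  have him : (rootStrip b x 0).im = 0 := by
    have h := congrArg Complex.im hsq
    rw [sq, Complex.mul_im, ← Complex.ofReal_pow, ← Complex.ofReal_pow, ← Complex.ofReal_sub,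
      Complex.ofReal_im] at h
    have : (rootStrip b x 0).re * (rootStrip b x 0).im = 0 := by linarith
    exact (mul_eq_zero.1 this).resolve_left hR.ne'
  have hre : (rootStrip b x 0).re ^ 2 = Real.sin x ^ 2 - Real.sin b ^ 2 := by
    have h := congrArg Complex.re hsq
    rw [sq, Complex.mul_re, him, ← Complex.ofReal_pow, ← Complex.ofReal_pow, ← Complex.ofReal_sub,
      Complex.ofReal_re] at h
    linarith
  have hcos : 0 ≤ Real.cos b := Real.cos_nonneg_of_mem_Icc ⟨by linarith, by linarith⟩
  refine (sq_eq_sq₀ (norm_nonneg _) hcos).1 ?_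
  rw [Complex.sq_norm, Complex.normSq_apply, hC, Complex.add_re, Complex.add_im,
    Complex.I_mul_re, Complex.I_mul_im, him, Complex.ofReal_re, Complex.ofReal_im]
  nlinarith [Real.sin_sq_add_cos_sq b, Real.sin_sq_add_cos_sq x]

lemma abs_Xfun_param_deriv_le {m : ℝ} (hb : 0 < b) (hbm : b ≤ m) (hmx : m < x) (hx : x ≤ π / 2)
    (t : ℝ) :
    |-(Real.cos b / Real.sin b) * ((sinStrip x t / rootStrip b x t).re - 1)|
      ≤ 1 / (√(Real.sin x ^ 2 - Real.sin m ^ 2) * Real.sin x) * (2 * Real.exp (-t)) := by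
  have hbx := hbm.trans_lt hmx
  obtain ⟨hs, hsx⟩ := sin_lt_sin_of_strip hb hbx hx
  obtain ⟨hm, hmsx⟩ := sin_lt_sin_of_strip (hb.trans_le hbm) hmx hx
  have h0 := hs.trans hsx
  have hsm : Real.sin b ≤ Real.sin m :=
    Real.sin_le_sin_of_le_of_le_pi_div_two (by linarith) (by linarith) hbm
  have hR := rootStrip_ne_zero hb hbx hx t
  have hSR := sinStrip_add_rootStrip_ne_zero hb hbx hx t
  have hs' : (Real.sin b : ℂ) ≠ 0 := by exact_mod_cast hs.ne'
  have hd : 0 < Real.sin x ^ 2 - Real.sin m ^ 2 := by nlinarith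
  have h4 : ((-(Real.cos b / Real.sin b) : ℝ) : ℂ) * (sinStrip x t / rootStrip b x t - 1)
      = -((Real.sin b * Real.cos b : ℝ) : ℂ)
        / (rootStrip b x t * (sinStrip x t + rootStrip b x t)) := by
    push_cast at hs' ⊢
    field_simp
    linear_combination Complex.cos b * rootStrip_sq b x t
  have h5 : -(Real.cos b / Real.sin b) * ((sinStrip x t / rootStrip b x t).re - 1)
      = (-((Real.sin b * Real.cos b : ℝ) : ℂ)
        / (rootStrip b x t * (sinStrip x t + rootStrip b x t))).re := by
    rw [← h4, Complex.re_ofReal_mul, Complex.sub_re, Complex.one_re]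
  rw [h5]
  refine (Complex.abs_re_le_norm _).trans ?_
  rw [norm_div, norm_neg, norm_mul, Complex.norm_real]
  have h6 : ‖Real.sin b * Real.cos b‖ ≤ 1 := by
    rw [norm_mul]
    exact mul_le_one₀ (Real.abs_sin_le_one b) (norm_nonneg _) (Real.abs_cos_le_one b)
  have h7 : √(Real.sin x ^ 2 - Real.sin m ^ 2) * Real.cosh t ≤ ‖rootStrip b x t‖ := by
    refine le_of_sq_le_sq ?_ (norm_nonneg _)
    rw [mul_pow, Real.sq_sqrt hd.le]
    refine le_trans ?_ (sq_mul_cosh_sq_le_norm_rootStrip_sq hb hbx hx t)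
    gcongr
  have h8 := le_norm_sinStrip_add_rootStrip hb hbx hx t
  have hc := Real.cosh_pos t
  have hsq := Real.sqrt_pos.2 hd
  calc _ ≤ 1 / ((√(Real.sin x ^ 2 - Real.sin m ^ 2) * Real.cosh t)
        * (Real.sin x * Real.cosh t)) := by gcongr
    _ = 1 / (√(Real.sin x ^ 2 - Real.sin m ^ 2) * Real.sin x) * (1 / Real.cosh t ^ 2) := by
        field_simp
    _ ≤ _ := by
        gcongr
        have h9 : Real.exp t / 2 ≤ Real.cosh t ^ 2 := by
          nlinarith [exp_div_two_le_cosh t, Real.one_le_cosh t]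
        rw [Real.exp_neg, div_le_iff₀ (by positivity)]
        have h10 := mul_inv_cancel₀ (Real.exp_ne_zero t)
        nlinarith [inv_pos.2 (Real.exp_pos t)]

end Strip

/-- For `ξ₁ ∈ (a, π/2]`, the `a`-derivative of `∫₀^∞ X(ξ₁,t,a) dt` equals
`cot a · ln cos a`; in particular it is independent of `ξ₁`. -/
theorem Xfun_integral_param_deriv (a : ℝ) (ha : a ∈ Set.Ioo 0 (π/2)) :
    ∀ ξ₁ ∈ Set.Ioc a (π/2),
      deriv (fun b => ∫ t in Set.Ioi (0 : ℝ), Xfun b (ξ₁, t)) a =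
        (Real.cos a / Real.sin a) * Real.log (Real.cos a) := by
  rintro x ⟨hax, hx⟩
  obtain ⟨ha0, -⟩ := ha
  obtain ⟨m, ham, hmx⟩ := exists_between hax
  have hmeas : Measurable (fun t => (sinStrip x t / rootStrip a x t).re - 1) := by
    unfold rootStrip sinStrip
    fun_prop
  obtain ⟨hint, hder⟩ := hasDerivAt_integral_of_dominated_loc_of_deriv_le
    (μ := volume.restrict (Ioi (0 : ℝ))) (F := fun b t => Xfun b (x, t))
    (F' := fun b t => -(Real.cos b / Real.sin b) * ((sinStrip x t / rootStrip b x t).re - 1))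
    (Ioo_mem_nhds ha0 ham)
    (Eventually.of_forall fun b => (measurable_Xfun_snd b x).aestronglyMeasurable)
    (integrableOn_Xfun ha0 hax hx)
    (hmeas.const_mul _).aestronglyMeasurable
    (Eventually.of_forall fun t b hb => abs_Xfun_param_deriv_le hb.1 hb.2.le hmx hx t)
    (((integrableOn_exp_neg_Ioi 0).const_mul 2).const_mul _)
    (Eventually.of_forall fun t b hb => hasDerivAt_Xfun_param hb.1 (hb.2.trans hmx) hx t)
  have hsin := (sin_lt_sin_of_strip ha0 hax hx).1
  have hcos : 0 < Real.cos a := Real.cos_pos_of_mem_Ioo ⟨by linarith, by linarith⟩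
  have hint' : IntegrableOn (fun t => (sinStrip x t / rootStrip a x t).re - 1) (Ioi 0) := by
    refine (hint.const_mul (-(Real.cos a / Real.sin a))⁻¹).congr (Eventually.of_forall fun t => ?_)
    exact inv_mul_cancel_left₀ (neg_ne_zero.2 (div_pos hcos hsin).ne') _
  have hval := integral_Ioi_of_hasDerivAt_of_tendsto
    (hasDerivAt_log_rootStrip_add ha0 hax hx le_rfl).continuousAt.continuousWithinAt
    (fun t ht => hasDerivAt_log_rootStrip_add ha0 hax hx (le_of_lt ht)) hint'
    (tendsto_log_rootStrip_add ha0 hax hx)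
  rw [hder.deriv, integral_const_mul, hval, Complex.log_re,
    norm_rootStrip_add_I_mul_cosStrip_zero ha0 hax hx]
  ring
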